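/- (Affine demand bound for a level-(m−1) task.) For every r ∈ [−T, 0], the total demand satisfies DEM(r) ≤ (S/T + 2)·C''; that is, the demand that a task of criticality level m−1 can generate in the interval [0, S) before it is dropped is at most C'' times (S/T + 2), an affine function of the mode-switch instant S. -/

import Mathlib

/-- `x mod T`: the unique element of `[0, T)` congruent to `x` modulo `T`. -/
noncomputable def rmod (x T : ℝ) : ℝ := x - T * (⌊x / T⌋ : ℤ)

/-- Demand in `[0, e)` of the carry-over job `J^A` (active at the switch into
level-(m−1) mode at time 0) of a level-(m−1) task, released at time `r`. -/
noncomputable def Adem (C' C'' D' D'' e S r : ℝ) : ℝ :=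
  if 0 ≤ r + D' ∧ r + D'' ≤ e then min (min (r + D') C' + C'' - C') S else 0

/-- Demand in `[0, e)` of the carry-over job `J^B` (active at the switch into
level-m mode at time `S`) of a level-(m−1) task, released at time `s`. -/
noncomputable def Bdem (C'' D'' e S s : ℝ) : ℝ :=
  if s + D'' ≤ e then min C'' (S - s) else 0

/-- Total demand of a level-(m−1) task in `[0, e)` when its carry-over job `J^A`
is released at time `r` and all subsequent jobs are released as early as
possible (every `T` time units). -/
noncomputable def DEM (T C' C'' D' D'' e S r : ℝ) : ℝ :=
  if S < r + T then Adem C' C'' D' D'' e S r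
  else Adem C' C'' D' D'' e S r
    + ((⌊(S - r - T) / T⌋ : ℤ) : ℝ) * C''
    + Bdem C'' D'' e S (r + (((⌊(S - r - T) / T⌋ : ℤ) : ℝ) + 1) * T)

theorem Adem_le {C' C'' : ℝ} (hC'' : 0 ≤ C'') (D' D'' e S r : ℝ) :
    Adem C' C'' D' D'' e S r ≤ C'' := by
  unfold Adem
  split_ifs
  · exact (min_le_left _ _).trans (by linarith [min_le_right (r + D') C'])
  · exact hC''

theorem Bdem_le {C'' : ℝ} (hC'' : 0 ≤ C'') (D'' e S s : ℝ) :
    Bdem C'' D'' e S s ≤ C'' := by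
  unfold Bdem
  split_ifs
  · exact min_le_left _ _
  · exact hC''

/-- Affine demand bound for a level-(m−1) task: its total demand in `[0, e)`
(it executes only in `[0, S)` before being dropped) is at most
`(S/T + 2)·C''`, an affine function of the mode-switch instant `S`. -/
theorem affine_demand_bound_level_m_minus_one
    (T C' C'' D' D'' e S : ℝ)
    (hT : 0 < T) (hC' : 0 < C') (hC'C'' : C' ≤ C'')
    (hC'D' : C' ≤ D') (hC''D'' : C'' ≤ D'')
    (hD'D'' : D' ≤ D'') (hD''T : D'' ≤ T)
    (hS0 : 0 ≤ S) (hSe : S ≤ e) :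
    ∀ r : ℝ, -T ≤ r → r ≤ 0 →
      DEM T C' C'' D' D'' e S r ≤ (S / T + 2) * C'' := by
  intro r hr _
  have hC'' : 0 ≤ C'' := hC'.le.trans hC'C''
  have hA := Adem_le (C' := C') hC'' D' D'' e S r
  unfold DEM
  split_ifs
  · have : 0 ≤ S / T * C'' := by positivity
    linarith
  · have hn : ((⌊(S - r - T) / T⌋ : ℤ) : ℝ) ≤ S / T :=
      (Int.floor_le _).trans (by gcongr; linarith)
    have hB := Bdem_le hC'' D'' e S (r + (((⌊(S - r - T) / T⌋ : ℤ) : ℝ) + 1) * T)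
    linarith [mul_le_mul_of_nonneg_right hn hC'']
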